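/- Let $G$ be an abelian group and $p$ a prime. The following are equivalent: (1) $G$ is $p$-divisible (i.e., $pG = G$); (2) $\mathrm{Ext}^1_{\mathbb{Z}}(\mathbb{Z}_{p^\infty}, G) = 0$; (3) $\mathrm{Ext}^1_{\mathbb{Z}}(\mathbb{Z}_{p^\infty}, G)$ is $p$-divisible. -/

import Mathlib

open CategoryTheory

/-- The group `ℚ/ℤ`. -/
noncomputable def QmodZ : Type := ℚ ⧸ AddSubgroup.zmultiples (1 : ℚ)

noncomputable instance : AddCommGroup QmodZ := by unfold QmodZ; infer_instance

/-- The Prüfer `p`-group `ℤ_{p^∞}`, realized as the `p`-primary component of `ℚ/ℤ`. -/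
noncomputable def PruferGroup (p : ℕ) [Fact p.Prime] : Type :=
  AddCommGroup.primaryComponent QmodZ p

noncomputable instance (p : ℕ) [Fact p.Prime] : AddCommGroup (PruferGroup p) := by
  unfold PruferGroup; infer_instance

/-- `Ext¹_ℤ(A, B)` of abelian groups, computed in the category of `ℤ`-modules. -/
noncomputable def Ext1 (A B : Type) [AddCommGroup A] [AddCommGroup B] : Type :=
  ((Ext ℤ (ModuleCat ℤ) 1).obj (Opposite.op (ModuleCat.of ℤ A))).obj (ModuleCat.of ℤ B)

noncomputable instance (A B : Type) [AddCommGroup A] [AddCommGroup B] :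
    AddCommGroup (Ext1 A B) := by unfold Ext1; infer_instance

namespace CategoryTheory.ShortComplex.ShortExact
open Limits ZeroObject
universe v u
variable {C : Type u} [Category.{v} C] [Abelian C] {S : ShortComplex C}

variable (S) in
/-- The chain complex `⋯ ⟶ 0 ⟶ S.X₁ ⟶ S.X₂`. -/
noncomputable def twoTermComplex : ChainComplex C ℕ :=
  ChainComplex.mk' S.X₂ S.X₁ S.f (fun _ => ⟨0, 0, zero_comp⟩)

lemma isZero_twoTermComplex_X (n : ℕ) : IsZero ((twoTermComplex S).X (n + 2)) := by
  cases n <;> exact isZero_zero C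

lemma twoTermComplex_d_one_zero : (twoTermComplex S).d 1 0 = S.f := by
  simp [twoTermComplex]

lemma twoTermComplex_d_comp_g : (twoTermComplex S).d 1 0 ≫ S.g = 0 := by
  rw [twoTermComplex_d_one_zero]
  exact S.zero

lemma twoTermComplex_exactAt_succ (hS : S.ShortExact) (n : ℕ) :
    (twoTermComplex S).ExactAt (n + 1) := by
  rw [HomologicalComplex.exactAt_iff' _ (n + 1 + 1) (n + 1) n (by simp) (by simp)]
  cases n with
  | zero =>
    have := hS.mono_f
    refine (ShortComplex.exact_iff_mono ((twoTermComplex S).sc' 2 1 0)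
      ((isZero_twoTermComplex_X (S := S) 0).eq_of_src _ _)).2 ?_
    exact (congrArg Mono (twoTermComplex_d_one_zero (S := S))).mpr this
  | succ n => exact ShortComplex.exact_of_isZero_X₂ _ (isZero_twoTermComplex_X n)

/-- A short exact sequence whose first two terms are projective is a projective resolution
of length one of its third term. -/
noncomputable def projectiveResolution (hS : S.ShortExact) [Projective S.X₁] [Projective S.X₂] :
    ProjectiveResolution S.X₃ where
  complex := twoTermComplex S
  projective n := by
    match n with
    | 0 => assumption
    | 1 => assumption
    | n + 2 => exact (isZero_twoTermComplex_X n).projective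
  π := (ChainComplex.toSingle₀Equiv _ _).symm ⟨S.g, twoTermComplex_d_comp_g⟩
  quasiIso := ⟨fun n => by
    cases n
    · rw [ChainComplex.quasiIsoAt₀_iff, ShortComplex.quasiIso_iff_of_zeros']
      · refine (ShortComplex.exact_and_epi_g_iff_of_iso ?_).2 ⟨hS.exact, hS.epi_g⟩
        exact ShortComplex.isoMk (Iso.refl _) (Iso.refl _) (Iso.refl _)
          ((Category.id_comp S.f).trans
            (twoTermComplex_d_one_zero.symm.trans (Category.comp_id _).symm))
          ((Category.id_comp S.g).trans (Eq.trans
            (ChainComplex.toSingle₀Equiv_symm_apply_f_zero (C := twoTermComplex S)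
              (f := S.g) twoTermComplex_d_comp_g).symm (Category.comp_id _).symm))
      all_goals rfl
    · rw [quasiIsoAt_iff_exactAt']
      · exact twoTermComplex_exactAt_succ hS _
      · apply ChainComplex.exactAt_succ_single_obj⟩

/-- If `0 ⟶ X₁ ⟶ X₂ ⟶ X₃ ⟶ 0` is exact with `X₁` and `X₂` projective, then `Ext¹(X₃, Y)` is the
cokernel of the restriction map `Hom(X₂, Y) → Hom(X₁, Y)`. -/
lemma exists_linearMap_ext_one {R : Type*} [Ring R] [Linear R C] [EnoughProjectives C]
    (hS : S.ShortExact) [Projective S.X₁] [Projective S.X₂] (Y : C) :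
    ∃ q : (S.X₁ ⟶ Y) →ₗ[R] ((Ext R C 1).obj (Opposite.op S.X₃)).obj Y,
      Function.Surjective q ∧ ∀ φ, q φ = 0 ↔ ∃ ψ : S.X₂ ⟶ Y, S.f ≫ ψ = φ := by
  let K := hS.projectiveResolution.complex.linearYonedaObj R Y
  let T := K.sc' 0 1 2
  have hg : T.g = 0 := by
    ext φ
    exact (isZero_twoTermComplex_X (S := S) 0).eq_of_src _ _
  have : IsIso T.homologyι := T.isIso_homologyι hg
  let e : T.homology ≅ ((Ext R C 1).obj (Opposite.op S.X₃)).obj Y :=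
    (ShortComplex.homologyMapIso (K.isoSc' 0 1 2 (by simp) (by simp))).symm ≪≫
      (hS.projectiveResolution.isoExt 1 Y).symm
  let i : T.opcycles ≅ _ := (asIso T.homologyι).symm ≪≫ e
  refine ⟨i.hom.hom ∘ₗ T.pOpcycles.hom, ?_, fun φ => ?_⟩
  · exact i.toLinearEquiv.surjective.comp ((ModuleCat.epi_iff_surjective _).1 inferInstance)
  · refine (i.toLinearEquiv.map_eq_zero_iff (x := T.pOpcycles.hom φ)).trans ?_
    refine (T.moduleCat_pOpcycles_eq_zero_iff φ).trans ?_
    refine exists_congr fun ψ => ?_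
    rw [← twoTermComplex_d_one_zero (S := S)]
    exact Iff.rfl

end CategoryTheory.ShortComplex.ShortExact

section Tower

variable {p : ℕ} {Q : Type*} [AddCommGroup Q] {e : ℕ → Q}

lemma pow_nsmul_of_tower (hs : ∀ n, p • e (n + 1) = e n) (n k : ℕ) :
    p ^ k • e (n + k) = e n := by
  induction k with
  | zero => simp
  | succ k ih => rw [pow_succ, mul_nsmul', ← add_assoc, hs, ih]

lemma pow_succ_nsmul_of_tower (h0 : p • e 0 = 0) (hs : ∀ n, p • e (n + 1) = e n) (n : ℕ) :
    p ^ (n + 1) • e n = 0 := by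
  have := pow_nsmul_of_tower hs 0 n
  rw [zero_add] at this
  rw [pow_succ', mul_nsmul', this, h0]

/-- Any linear combination of the members of a tower `p • e (n + 1) = e n` is a multiple of a
single one of them, with index and coefficient independent of the tower. -/
lemma exists_linearCombination_eq_zsmul_of_tower (p : ℕ) (x : ℕ →₀ ℤ) :
    ∃ (n : ℕ) (a : ℤ), ∀ {Q : Type} [AddCommGroup Q] {e : ℕ → Q},
      (∀ n, p • e (n + 1) = e n) → Finsupp.linearCombination ℤ e x = a • e n := by
  induction x using Finsupp.induction_linear with
  | zero => exact ⟨0, 0, fun _ => by simp⟩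
  | single n a => exact ⟨n, a, fun _ => by simp⟩
  | add x y hx hy =>
    obtain ⟨n, a, hx⟩ := hx
    obtain ⟨m, b, hy⟩ := hy
    refine ⟨n + m, a * (p ^ m : ℕ) + b * (p ^ n : ℕ), fun {Q} _ {e} hs => ?_⟩
    rw [map_add, hx hs, hy hs, ← pow_nsmul_of_tower hs n m, ← pow_nsmul_of_tower hs m n,
      add_comm m n, add_smul, mul_smul, mul_smul, natCast_zsmul, natCast_zsmul]

end Tower

/-- The quotient map `ℚ → ℚ/ℤ`. -/
noncomputable def QmodZ.mk : ℚ →+ QmodZ :=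
  QuotientAddGroup.mk' (AddSubgroup.zmultiples (1 : ℚ))

lemma QmodZ.mk_surjective : Function.Surjective QmodZ.mk :=
  QuotientAddGroup.mk'_surjective _

lemma QmodZ.mk_eq_zero_iff (r : ℚ) : QmodZ.mk r = 0 ↔ ∃ n : ℤ, (n : ℚ) = r :=
  (QuotientAddGroup.eq_zero_iff r).trans (by simp [AddSubgroup.mem_zmultiples_iff])

namespace PruferGroup

variable (p : ℕ) [Fact p.Prime]

/-- The inclusion of the Prüfer group in `ℚ/ℤ`. -/
noncomputable def incl : PruferGroup p →+ QmodZ :=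
  (AddCommGroup.primaryComponent QmodZ p).subtype

lemma incl_injective : Function.Injective (incl p) := Subtype.val_injective

variable {p} in
lemma exists_pow_nsmul_incl_eq_zero (x : PruferGroup p) : ∃ k : ℕ, p ^ k • incl p x = 0 :=
  x.2

/-- The class of `1 / p ^ (n + 1)`. -/
noncomputable def gen (n : ℕ) : PruferGroup p :=
  ⟨QmodZ.mk (1 / (p : ℚ) ^ (n + 1)), n + 1, by
    have hp : (p : ℚ) ≠ 0 := Nat.cast_ne_zero.2 (Fact.out : p.Prime).ne_zero
    rw [← map_nsmul, QmodZ.mk_eq_zero_iff]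
    exact ⟨1, by simp [hp]⟩⟩

lemma incl_gen (n : ℕ) : incl p (gen p n) = QmodZ.mk (1 / (p : ℚ) ^ (n + 1)) := rfl

lemma nsmul_gen_zero : p • gen p 0 = 0 := by
  have hp : (p : ℚ) ≠ 0 := Nat.cast_ne_zero.2 (Fact.out : p.Prime).ne_zero
  apply incl_injective
  rw [map_nsmul, incl_gen, ← map_nsmul, map_zero, QmodZ.mk_eq_zero_iff]
  exact ⟨1, by simp [hp]⟩

lemma nsmul_gen_succ (n : ℕ) : p • gen p (n + 1) = gen p n := by
  have hp : (p : ℚ) ≠ 0 := Nat.cast_ne_zero.2 (Fact.out : p.Prime).ne_zero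
  apply incl_injective
  rw [map_nsmul, incl_gen, ← map_nsmul, incl_gen]
  congr 1
  rw [nsmul_eq_mul]
  field_simp
  ring

/-- The images in `ℤ^(ℕ)` of the basis vectors of the module of relations between the
generators `gen p n`. -/
noncomputable def relator : ℕ → ℕ →₀ ℤ
  | 0 => Finsupp.single 0 (p : ℤ)
  | n + 1 => Finsupp.single (n + 1) (p : ℤ) - Finsupp.single n 1

/-- The module of relations between the generators `gen p n`. -/
noncomputable def relations : (ℕ →₀ ℤ) →ₗ[ℤ] (ℕ →₀ ℤ) :=
  Finsupp.linearCombination ℤ (relator p)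

/-- The surjection `ℤ^(ℕ) → ℤ_{p^∞}` given by the generators `gen p n`. -/
noncomputable def proj : (ℕ →₀ ℤ) →ₗ[ℤ] PruferGroup p :=
  Finsupp.linearCombination ℤ (gen p)

omit [Fact p.Prime] in
lemma relations_apply (c : ℕ →₀ ℤ) (n : ℕ) : relations p c n = p * c n - c (n + 1) := by
  induction c using Finsupp.induction_linear with
  | zero => simp
  | add x y hx hy => rw [map_add, Finsupp.add_apply, hx, hy]; simp; ring
  | single m a =>
    rw [relations, Finsupp.linearCombination_single]
    cases m with
    | zero => simp [relator, Finsupp.single_apply]; grind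
    | succ m => simp [relator, Finsupp.single_apply]; grind

lemma relations_injective : Function.Injective (relations p) := by
  rw [injective_iff_map_eq_zero]
  intro c hc
  have hs : ∀ n, c (n + 1) = p * c n := fun n => by
    have := relations_apply p c n
    rw [hc, Finsupp.zero_apply] at this
    omega
  ext m
  have hk : ∀ k, c (m + k) = p ^ k * c m := fun k => by
    induction k with
    | zero => simp
    | succ k ih => rw [← add_assoc, hs, ih]; ring
  obtain ⟨N, hN⟩ := c.support.exists_nat_subset_range
  have hmN : c (m + N) = 0 := by
    by_contra h
    have := Finset.mem_range.1 (hN (Finsupp.mem_support_iff.2 h))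
    omega
  rw [hk] at hmN
  exact (mul_eq_zero.1 hmN).resolve_left
    (pow_ne_zero _ (Nat.cast_ne_zero.2 (Fact.out : p.Prime).ne_zero))

lemma proj_surjective : Function.Surjective (proj p) := by
  intro x
  have hp : (p : ℚ) ≠ 0 := Nat.cast_ne_zero.2 (Fact.out : p.Prime).ne_zero
  obtain ⟨k, hk⟩ := exists_pow_nsmul_incl_eq_zero x
  obtain ⟨r, hr⟩ := QmodZ.mk_surjective (incl p x)
  rw [← hr, ← map_nsmul, QmodZ.mk_eq_zero_iff] at hk
  obtain ⟨n, hn⟩ := hk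
  refine ⟨Finsupp.single k (n * p), incl_injective p ?_⟩
  rw [proj, Finsupp.linearCombination_single, map_zsmul, incl_gen, ← map_zsmul, ← hr]
  congr 1
  rw [nsmul_eq_mul, Nat.cast_pow] at hn
  rw [zsmul_eq_mul, Int.cast_mul, hn, Int.cast_natCast]
  field_simp
  ring

lemma pow_succ_dvd_of_zsmul_gen_eq_zero {a : ℤ} {n : ℕ} (h : a • gen p n = 0) :
    (p ^ (n + 1) : ℤ) ∣ a := by
  have hp : (p : ℚ) ≠ 0 := Nat.cast_ne_zero.2 (Fact.out : p.Prime).ne_zero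
  have h' := congrArg (incl p) h
  rw [map_zsmul, incl_gen, ← map_zsmul, map_zero, QmodZ.mk_eq_zero_iff] at h'
  obtain ⟨b, hb⟩ := h'
  refine ⟨b, ?_⟩
  rw [zsmul_eq_mul, mul_one_div, eq_div_iff (pow_ne_zero _ hp)] at hb
  rw [mul_comm]
  exact_mod_cast hb.symm

lemma relations_exact : Function.Exact (relations p) (proj p) := by
  rw [LinearMap.exact_iff]
  apply le_antisymm
  · intro x hx
    let R := LinearMap.range (relations p)
    let e : ℕ → (ℕ →₀ ℤ) ⧸ R := fun n => R.mkQ (Finsupp.single n 1)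
    have hrel (n : ℕ) : R.mkQ (relator p n) = 0 :=
      (Submodule.Quotient.mk_eq_zero R).2 ⟨Finsupp.single n 1, by simp [relations]⟩
    have hsingle (n : ℕ) : R.mkQ (Finsupp.single n (p : ℤ)) = p • e n := by
      rw [← map_nsmul, Finsupp.smul_single, nsmul_one]
    have h0 : p • e 0 = 0 := by rw [← hsingle]; exact hrel 0
    have hs (n : ℕ) : p • e (n + 1) = e n := by
      rw [← hsingle, ← sub_eq_zero, ← map_sub]
      exact hrel (n + 1)
    obtain ⟨n, a, hna⟩ := exists_linearCombination_eq_zsmul_of_tower p x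
    obtain ⟨b, rfl⟩ := pow_succ_dvd_of_zsmul_gen_eq_zero p
      ((hna (nsmul_gen_succ p)).symm.trans hx)
    have hmk : Finsupp.linearCombination ℤ e = R.mkQ := by
      ext n
      simp [e]
    apply (Submodule.Quotient.mk_eq_zero R).1
    rw [← Submodule.mkQ_apply, ← hmk, hna hs, mul_comm, mul_smul, ← Nat.cast_pow, natCast_zsmul,
      pow_succ_nsmul_of_tower h0 hs, smul_zero]
  · rintro _ ⟨c, rfl⟩
    suffices proj p ∘ₗ relations p = 0 from LinearMap.congr_fun this c
    ext n
    cases n with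
    | zero => simp [proj, relations, relator, nsmul_gen_zero]
    | succ n => simp [proj, relations, relator, nsmul_gen_succ]

/-- The free presentation of the Prüfer group by the generators `gen p n`. -/
noncomputable abbrev presentation : ShortComplex (ModuleCat ℤ) :=
  ShortComplex.moduleCatMk (relations p) (proj p) (relations_exact p).linearMap_comp_eq_zero

lemma presentation_shortExact : (presentation p).ShortExact :=
  ModuleCat.shortComplex_shortExact _ (relations_exact p) (relations_injective p)
    (proj_surjective p)

/-- `Ext¹(ℤ_{p^∞}, G)` is the quotient of the group of sequences in `G` by the sequences
`n ↦ p b_n - b_{n - 1}`, where `b_{-1} = 0`. -/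
lemma exists_addMonoidHom_ext1 (G : Type) [AddCommGroup G] :
    ∃ q : (ℕ → G) →+ Ext1 (PruferGroup p) G, Function.Surjective q ∧
      ∀ g, q g = 0 ↔ ∃ b : ℕ → G, p • b 0 = g 0 ∧ ∀ n, p • b (n + 1) - b n = g (n + 1) := by
  have : Projective (presentation p).X₁ := ModuleCat.projective_of_free Finsupp.basisSingleOne
  have : Projective (presentation p).X₂ := ModuleCat.projective_of_free Finsupp.basisSingleOne
  obtain ⟨q, hq, hker⟩ := (presentation_shortExact p).exists_linearMap_ext_one (R := ℤ)
    (ModuleCat.of ℤ G)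
  let f : (ℕ → G) ≃+ (ModuleCat.of ℤ (ℕ →₀ ℤ) ⟶ ModuleCat.of ℤ G) :=
    (Finsupp.lift G ℤ ℕ).trans
      (ModuleCat.homAddEquiv (M := ModuleCat.of ℤ (ℕ →₀ ℤ)) (N := ModuleCat.of ℤ G)).symm
  refine ⟨q.toAddMonoidHom.comp f.toAddMonoidHom, hq.comp f.surjective, fun g => ?_⟩
  refine (hker (f g)).trans (f.surjective.exists.trans (exists_congr fun b => ?_))
  have hrel : Finsupp.lift G ℤ ℕ b ∘ₗ relations p = Finsupp.lift G ℤ ℕ g ↔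
      ∀ n, Finsupp.lift G ℤ ℕ b (relator p n) = g n := by
    refine ⟨fun h n => ?_, fun h => ?_⟩
    · simpa [relations] using LinearMap.congr_fun h (Finsupp.single n 1)
    · ext n
      simpa [relations] using h n
  refine (ModuleCat.hom_ext_iff.trans hrel).trans ?_
  rw [← Nat.and_forall_add_one]
  simp only [relator, map_sub]
  simp

end PruferGroup

/-- For an abelian group `G` and a prime `p`, the following are
equivalent: (1) `G` is `p`-divisible; (2) `Ext¹_ℤ(ℤ_{p^∞}, G) = 0`;
(3) `Ext¹_ℤ(ℤ_{p^∞}, G)` is `p`-divisible. -/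
theorem pDivisible_iff_ext_prufer_tfae (p : ℕ) [Fact p.Prime]
    (G : Type) [AddCommGroup G] :
    List.TFAE
      [∀ x : G, ∃ y : G, p • y = x,
        Subsingleton (Ext1 (PruferGroup p) G),
        ∀ x : Ext1 (PruferGroup p) G, ∃ y, p • y = x] := by
  obtain ⟨q, hq, hker⟩ := PruferGroup.exists_addMonoidHom_ext1 p G
  tfae_have 1 → 2 := by
    intro h
    choose f hf using h
    refine subsingleton_of_forall_eq 0 (hq.forall.2 fun g => (hker g).2 ?_)
    refine ⟨Nat.rec (f (g 0)) fun n b => f (g (n + 1) + b), hf _, fun n => ?_⟩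
    rw [sub_eq_iff_eq_add]
    exact hf _
  tfae_have 2 → 3 := fun _ x => ⟨0, Subsingleton.elim _ _⟩
  tfae_have 3 → 1 := by
    intro h x
    obtain ⟨y, hy⟩ := h (q fun _ => x)
    obtain ⟨g, rfl⟩ := hq y
    rw [eq_comm, ← map_nsmul, ← sub_eq_zero, ← map_sub, hker] at hy
    obtain ⟨b, hb, -⟩ := hy
    exact ⟨b 0 + g 0, by rw [smul_add, hb]; simp⟩
  tfae_finish
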